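/- If U is a p-point ultrafilter on ω, then U·U ≤_T U × ∏_{n<ω} fin, where fin is the ideal of finite subsets of ω ordered by ⊆ (and hence U·U ≤_T U × (ω^ω, ≤) with the everywhere-domination order). -/

import Mathlib

open Set

/-- A subset `S` is bounded with respect to the relation `r`. -/
def RelBounded {α : Type*} (r : α → α → Prop) (S : Set α) : Prop :=
  ∃ b, ∀ a ∈ S, r a b

/-- Tukey reducibility between two ordered sets: there is a map sending every
unbounded set to an unbounded set. -/
def TukeyLE {α β : Type*} (ra : α → α → Prop) (rb : β → β → Prop) : Prop :=
  ∃ f : α → β, ∀ S : Set α, ¬ RelBounded ra S → ¬ RelBounded rb (f '' S)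

/-- Tukey equivalence. -/
def TukeyEquiv {α β : Type*} (ra : α → α → Prop) (rb : β → β → Prop) : Prop :=
  TukeyLE ra rb ∧ TukeyLE rb ra

/-- `S` is cofinal with respect to the relation `r`. -/
def IsCofinalIn {α : Type*} (r : α → α → Prop) (S : Set α) : Prop :=
  ∀ a, ∃ b ∈ S, r a b

/-- The poset `(U, ⊇)` associated to a filter `U`: `A ≤ B` iff `A ⊇ B`. -/
def filtRel {X : Type*} (U : Filter X) :
    {A : Set X // A ∈ U} → {A : Set X // A ∈ U} → Prop :=
  fun A B => B.1 ⊆ A.1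

/-- The poset `(I, ⊆)` associated to a family of sets `I`. -/
def subRel {X : Type*} (I : Set (Set X)) :
    {A : Set X // A ∈ I} → {A : Set X // A ∈ I} → Prop :=
  fun A B => A.1 ⊆ B.1

/-- The Fubini product of filters: `A ∈ U·V` iff `{x | (A)_x ∈ V} ∈ U`,
where `(A)_x = {y | (x, y) ∈ A}`. -/
def fubini {X Y : Type*} (U : Filter X) (V : Filter Y) : Filter (X × Y) :=
  U.bind fun x => V.map (Prod.mk x)

/-- The ω-fold power of an ordered set, with the everywhere (pointwise)
domination order. -/
def seqRel {α : Type*} (r : α → α → Prop) : (ℕ → α) → (ℕ → α) → Prop :=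
  fun f g => ∀ n, r (f n) (g n)

/-- The product order on a Cartesian product of two ordered sets. -/
def prodRel {α β : Type*} (ra : α → α → Prop) (rb : β → β → Prop) :
    α × β → α × β → Prop :=
  fun p q => ra p.1 q.1 ∧ rb p.2 q.2

/-- The everywhere domination order on `ω^ω`. -/
def domRel : (ℕ → ℕ) → (ℕ → ℕ) → Prop := fun f g => ∀ n, f n ≤ g n

/-- An ideal on `X`: a family of subsets containing `∅`, closed under subsets
and finite unions. -/
def IsIdeal {X : Type*} (I : Set (Set X)) : Prop :=
  ∅ ∈ I ∧ (∀ A ∈ I, ∀ B ⊆ A, B ∈ I) ∧ (∀ A ∈ I, ∀ B ∈ I, A ∪ B ∈ I)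

/-- `U` has the `I`-pseudo-intersection property: every ω-sequence of members of `U`
has a pseudo-intersection modulo `I` in `U`. -/
def HasPIP {X : Type*} (U : Filter X) (I : Set (Set X)) : Prop :=
  ∀ A : ℕ → Set X, (∀ n, A n ∈ U) → ∃ B ∈ U, ∀ n, B \ A n ∈ I

/-- A p-point: a nonprincipal ultrafilter on `ω` which has the fin-pseudo-intersection
property. -/
def IsPPoint (U : Ultrafilter ℕ) : Prop :=
  (∀ a : ℕ, (U : Filter ℕ) ≠ pure a) ∧
  ∀ A : ℕ → Set ℕ, (∀ n, A n ∈ U) → ∃ B ∈ U, ∀ n, (B \ A n).Finite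

/-- A rapid ultrafilter: a nonprincipal ultrafilter `U` on `ω` such that for every
increasing `f : ω → ω` there is `X ∈ U` with `|X ∩ f(n)| ≤ n` for all `n`. -/
def IsRapid (U : Ultrafilter ℕ) : Prop :=
  (∀ a : ℕ, (U : Filter ℕ) ≠ pure a) ∧
  ∀ f : ℕ → ℕ, StrictMono f → ∃ X ∈ U, ∀ n, (X ∩ Set.Iio (f n)).ncard ≤ n

/-- The ideal `fin ⊗ fin` on `ω × ω`: all sets with only finitely many infinite
vertical sections. -/
def finOtimesFin : Set (Set (ℕ × ℕ)) :=
  {A | {n : ℕ | {m : ℕ | (n, m) ∈ A}.Infinite}.Finite}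

theorem TukeyLE.of_relBounded {α β : Type*} {ra : α → α → Prop} {rb : β → β → Prop}
    (f : α → β) (hf : ∀ S b, (∀ a ∈ S, rb (f a) b) → RelBounded ra S) : TukeyLE ra rb :=
  ⟨f, fun S hS ⟨b, hb⟩ => hS (hf S b fun _ ha => hb _ (mem_image_of_mem f ha))⟩

theorem TukeyLE.trans {α β γ : Type*} {ra : α → α → Prop} {rb : β → β → Prop}
    {rc : γ → γ → Prop} (hab : TukeyLE ra rb) (hbc : TukeyLE rb rc) : TukeyLE ra rc := by
  obtain ⟨f, hf⟩ := hab
  obtain ⟨g, hg⟩ := hbc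
  refine ⟨g ∘ f, fun S hS => ?_⟩
  rw [image_comp]
  exact hg _ (hf S hS)

theorem TukeyLE.prod_left {α β γ : Type*} {ra : α → α → Prop} {rb : β → β → Prop}
    {rc : γ → γ → Prop} (h : TukeyLE rb rc) : TukeyLE (prodRel ra rb) (prodRel ra rc) := by
  obtain ⟨f, hf⟩ := h
  refine TukeyLE.of_relBounded (fun p => (p.1, f p.2)) ?_
  rintro S ⟨a, c⟩ hS
  have hbdd : RelBounded rb (Prod.snd '' S) := by
    by_contra hb
    refine hf _ hb ⟨c, ?_⟩
    rintro _ ⟨_, ⟨p, hp, rfl⟩, rfl⟩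
    exact (hS p hp).2
  obtain ⟨b, hb⟩ := hbdd
  exact ⟨(a, b), fun p hp => ⟨(hS p hp).1, hb _ (mem_image_of_mem _ hp)⟩⟩

theorem tukeyLE_domRel_seqRel_finite :
    TukeyLE domRel (seqRel (subRel {A : Set ℕ | A.Finite})) := by
  refine TukeyLE.of_relBounded (fun f n => ⟨Iio (f n), finite_Iio (f n)⟩) ?_
  intro S F hF
  have hbdd : ∀ n, ∃ m, ∀ k ∈ (F n).1, k < m := fun n => by
    obtain ⟨m, hm⟩ := (F n).2.bddAbove
    exact ⟨m + 1, fun k hk => Nat.lt_succ_of_le (hm hk)⟩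
  choose g hg using hbdd
  exact ⟨g, fun f hf n => le_of_forall_lt fun k hk => hg n k (hF f hf n hk)⟩

theorem mem_fubini {X Y : Type*} {U : Filter X} {V : Filter Y} {A : Set (X × Y)} :
    A ∈ fubini U V ↔ {x | {y | (x, y) ∈ A} ∈ V} ∈ U := Iff.rfl

theorem Ultrafilter.Ici_mem_of_ne_pure {U : Ultrafilter ℕ}
    (hU : ∀ a : ℕ, (U : Filter ℕ) ≠ pure a) (n : ℕ) : Ici n ∈ U := by
  rw [← compl_Iio, Ultrafilter.compl_mem_iff_notMem]
  intro h
  obtain ⟨a, -, ha⟩ := Ultrafilter.eq_pure_of_finite_mem (finite_Iio n) h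
  exact hU a (by rw [ha]; rfl)

/-- For a p-point, each set in the Fubini square contains, above the graph of some function,
the square of some member of the p-point. -/
theorem IsPPoint.exists_mem_forall_of_mem_fubini {U : Ultrafilter ℕ} (hU : IsPPoint U)
    {A : Set (ℕ × ℕ)} (hA : A ∈ fubini (U : Filter ℕ) (U : Filter ℕ)) :
    ∃ B ∈ (U : Filter ℕ), ∃ h : ℕ → ℕ, ∀ x ∈ B, ∀ y ∈ B, h x ≤ y → (x, y) ∈ A := by
  classical
  set X := {x | {y | (x, y) ∈ A} ∈ (U : Filter ℕ)}
  obtain ⟨B, hB, hfin⟩ := hU.2 (fun x => if x ∈ X then {y | (x, y) ∈ A} else univ) (by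
    intro x
    by_cases hx : x ∈ X
    · simp only [hx, if_true]
      exact hx
    · simp only [hx, if_false]
      exact Filter.univ_mem)
  choose m hm using fun x => (hfin x).bddAbove
  refine ⟨X ∩ B, Filter.inter_mem (mem_fubini.1 hA) hB, fun x => m x + 1, ?_⟩
  rintro x ⟨hxX, -⟩ y ⟨-, hyB⟩ hxy
  by_contra hxyA
  have hle : y ≤ m x := hm x ⟨hyB, by simpa only [hxX, if_true, mem_ofPred_eq] using hxyA⟩
  lia

theorem IsPPoint.tukeyLE_fubini_domRel {U : Ultrafilter ℕ} (hU : IsPPoint U) :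
    TukeyLE (filtRel (fubini (U : Filter ℕ) (U : Filter ℕ)))
      (prodRel (filtRel (U : Filter ℕ)) domRel) := by
  choose B hB h hBh using
    fun A : {A // A ∈ fubini (U : Filter ℕ) (U : Filter ℕ)} =>
      hU.exists_mem_forall_of_mem_fubini A.2
  refine TukeyLE.of_relBounded (fun A => (⟨B A, hB A⟩, h A)) ?_
  rintro S ⟨⟨D, hD⟩, g⟩ hS
  refine ⟨⟨{p | p.1 ∈ D ∧ p.2 ∈ D ∧ g p.1 ≤ p.2}, ?_⟩, ?_⟩
  · refine mem_fubini.2 (Filter.mem_of_superset hD fun x hx => ?_)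
    filter_upwards [hD, Ultrafilter.Ici_mem_of_ne_pure hU.1 (g x)] with y hy hxy
    exact ⟨hx, hy, hxy⟩
  · rintro A hA ⟨x, y⟩ ⟨hx, hy, hxy⟩
    obtain ⟨hDB, hhg⟩ := hS A hA
    exact hBh A x (hDB hx) y (hDB hy) ((hhg x).trans hxy)

/-- If `U` is a p-point on `ω`, then `U·U ≤_T U × ∏_{n<ω} fin`,
and hence `U·U ≤_T U × (ω^ω, ≤)`. -/
theorem stmt4 (U : Ultrafilter ℕ) (hU : IsPPoint U) :
    TukeyLE (filtRel (fubini (U : Filter ℕ) (U : Filter ℕ)))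
      (prodRel (filtRel (U : Filter ℕ)) (seqRel (subRel {A : Set ℕ | A.Finite}))) ∧
    TukeyLE (filtRel (fubini (U : Filter ℕ) (U : Filter ℕ)))
      (prodRel (filtRel (U : Filter ℕ)) domRel) := by
  exact ⟨hU.tukeyLE_fubini_domRel.trans tukeyLE_domRel_seqRel_finite.prod_left,
    hU.tukeyLE_fubini_domRel⟩
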